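/- Let B be a unital C*-algebra in which the linear span of the projections of B is dense, and let f be a state on B. Then f is multiplicative on B (i.e., f(ab) = f(a)f(b) for all a, b in B) if and only if f(p) ∈ {0,1} for every projection p in B. -/

import Mathlib

open scoped ComplexOrder

/-- A projection in a C*-algebra: a self-adjoint idempotent. -/
def IsProjection {B : Type*} [CStarAlgebra B] (p : B) : Prop :=
  star p = p ∧ p * p = p

/-- A state on a unital C*-algebra: a positive linear functional sending `1` to `1`. -/
def IsState {B : Type*} [CStarAlgebra B] (f : B →ₗ[ℂ] ℂ) : Prop :=
  (∀ a : B, 0 ≤ f (star a * a)) ∧ f 1 = 1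

/-- A positive functional on a C*-algebra that vanishes on `star a * a` vanishes on the left ideal
generated by `a`. -/
theorem PositiveLinearMap.apply_mul_eq_zero {B : Type*} [NonUnitalCStarAlgebra B] [PartialOrder B]
    [StarOrderedRing B] (f : B →ₚ[ℂ] ℂ) {a : B} (ha : f (star a * a) = 0) (b : B) :
    f (b * a) = 0 := by
  have hnorm : ‖f.toPreGNS a‖ = 0 := by simp [f.preGNS_norm_def, ha]
  have h := norm_inner_le_norm (𝕜 := ℂ) (f.toPreGNS (star b)) (f.toPreGNS a)
  rw [hnorm, mul_zero] at h
  simpa [f.preGNS_inner_def] using h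

theorem IsProjection.one_sub {B : Type*} [CStarAlgebra B] {p : B} (hp : IsProjection p) :
    IsProjection (1 - p) :=
  ⟨by rw [star_sub, star_one, hp.1], IsIdempotentElem.one_sub hp.2⟩

/-- A state on a C*-algebra comes from a positive linear map for any compatible order. -/
theorem IsState.exists_positiveLinearMap {B : Type*} [CStarAlgebra B] [PartialOrder B]
    [StarOrderedRing B] {f : B →ₗ[ℂ] ℂ} (hf : IsState f) : ∃ g : B →ₚ[ℂ] ℂ, ∀ a, g a = f a := by
  refine ⟨.mk₀ f fun a ha => ?_, fun _ => rfl⟩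
  obtain ⟨b, rfl⟩ := CStarAlgebra.nonneg_iff_eq_star_mul_self.mp ha
  exact hf.1 b

theorem IsState.continuous {B : Type*} [CStarAlgebra B] {f : B →ₗ[ℂ] ℂ} (hf : IsState f) :
    Continuous f := by
  let _ := CStarAlgebra.spectralOrder B
  have _ := CStarAlgebra.spectralOrderedRing B
  obtain ⟨g, hg⟩ := hf.exists_positiveLinearMap
  exact (map_continuous g).congr hg

theorem IsState.apply_mul_eq_zero {B : Type*} [CStarAlgebra B] {f : B →ₗ[ℂ] ℂ} (hf : IsState f)
    {p : B} (hp : IsProjection p) (h : f p = 0) (b : B) : f (b * p) = 0 := by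
  let _ := CStarAlgebra.spectralOrder B
  have _ := CStarAlgebra.spectralOrderedRing B
  obtain ⟨g, hg⟩ := hf.exists_positiveLinearMap
  rw [← hg]
  exact g.apply_mul_eq_zero (by rw [hp.1, hp.2, hg, h]) b

/-- A projection on which a state takes the value `0` or `1` is in its multiplicative domain. -/
theorem IsState.apply_mul_of_zero_or_one {B : Type*} [CStarAlgebra B] {f : B →ₗ[ℂ] ℂ}
    (hf : IsState f) {p : B} (hp : IsProjection p) (h : f p = 0 ∨ f p = 1) (b : B) :
    f (b * p) = f b * f p := by
  rcases h with h | h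
  · rw [hf.apply_mul_eq_zero hp h, h, mul_zero]
  · have h' := hf.apply_mul_eq_zero hp.one_sub (by rw [map_sub, hf.2, h, sub_self]) b
    rw [mul_sub, mul_one, map_sub, sub_eq_zero] at h'
    rw [← h', h, mul_one]

/-- If the linear span of the projections of a unital C*-algebra `B` is dense, then a state
`f` on `B` is multiplicative iff `f(p) ∈ {0, 1}` for every projection `p` of `B`. -/
theorem state_multiplicative_iff_projections_zero_one
    {B : Type*} [CStarAlgebra B]
    (hdense : Dense ((Submodule.span ℂ {p : B | IsProjection p} : Submodule ℂ B) : Set B))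
    (f : B →ₗ[ℂ] ℂ) (hf : IsState f) :
    (∀ a b : B, f (a * b) = f a * f b) ↔
      (∀ p : B, IsProjection p → f p = 0 ∨ f p = 1) := by
  constructor
  · intro hmul p hp
    have h : f p * f p = f p := by rw [← hmul, hp.2]
    exact IsIdempotentElem.iff_eq_zero_or_one.mp h
  · intro hproj a b
    have hcont := hf.continuous
    have heq : (fun x => f (a * x)) = fun x => f a * f x := by
      refine Continuous.ext_on hdense (by fun_prop) (by fun_prop) fun x hx => ?_
      exact LinearMap.eqOn_span (f := f ∘ₗ LinearMap.mulLeft ℂ a) (g := f a • f)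
        (fun p hp => hf.apply_mul_of_zero_or_one hp (hproj p hp) a) hx
    exact congrFun heq b
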